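/- arXiv:1606.02989 — 9 statements merged into one kernel-verified Lean document; each statement's English description precedes it below -/
import Mathlib

section
/- Let F : ℝ → ℝ be infinitely differentiable and suppose that for every x ∈ ℝ there exists an integer k ≥ 1 such that the k-th derivative of F at x is nonzero. Then every critical point of F is isolated: for every x with F'(x) = 0 there exists ε > 0 such that F'(z) ≠ 0 for all z with 0 < |z − x| < ε. -/
/-- A smooth function with a nonzero derivative of some order (possibly zero) at `x` does not
vanish on some punctured ball around `x`. -/
lemma exists_punctured_ball_ne_zero_of_iteratedDeriv_ne_zero (k : ℕ) {G : ℝ → ℝ}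
    (hG : ContDiff ℝ (⊤ : ℕ∞) G) {x : ℝ} (hk : iteratedDeriv k G x ≠ 0) :
    ∃ ε > 0, ∀ z : ℝ, 0 < |z - x| → |z - x| < ε → G z ≠ 0 := by
  induction k generalizing G with
  | zero =>
    obtain ⟨ε, hε, h⟩ := Metric.eventually_nhds_iff.1
      (hG.continuous.continuousAt.eventually_ne (by simpa using hk : G x ≠ 0))
    exact ⟨ε, hε, fun z _ hz => h (by rwa [Real.dist_eq])⟩
  | succ k ih =>
    by_cases hx : G x = 0
    · rw [iteratedDeriv_succ'] at hk
      obtain ⟨ε, hε, h⟩ := ih (contDiff_infty_iff_deriv.1 hG).2 hk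
      refine ⟨ε, hε, fun z hz0 hzε hGz => ?_⟩
      have hzx : z ≠ x := sub_ne_zero.1 (abs_pos.1 hz0)
      have hab := abs_lt.1 hzε
      rcases hzx.lt_or_gt with hlt | hgt
      · obtain ⟨c, ⟨hc1, hc2⟩, hc⟩ :=
          exists_deriv_eq_zero hlt hG.continuous.continuousOn (hGz.trans hx.symm)
        exact h c (abs_pos.2 (sub_ne_zero.2 hc2.ne)) (abs_lt.2 ⟨by linarith, by linarith⟩) hc
      · obtain ⟨c, ⟨hc1, hc2⟩, hc⟩ :=
          exists_deriv_eq_zero hgt hG.continuous.continuousOn (hx.trans hGz.symm)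
        exact h c (abs_pos.2 (sub_ne_zero.2 hc1.ne')) (abs_lt.2 ⟨by linarith, by linarith⟩) hc
    · obtain ⟨ε, hε, h⟩ := Metric.eventually_nhds_iff.1
        (hG.continuous.continuousAt.eventually_ne hx)
      exact ⟨ε, hε, fun z _ hz => h (by rwa [Real.dist_eq])⟩

/-- If `F : ℝ → ℝ` is smooth and at every point some derivative of order `k ≥ 1`
is nonzero, then every critical point of `F` is isolated. -/
theorem isolated_critical_points
    (F : ℝ → ℝ) (hF : ContDiff ℝ (⊤ : ℕ∞) F)
    (hnd : ∀ x : ℝ, ∃ k : ℕ, 1 ≤ k ∧ iteratedDeriv k F x ≠ 0) :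
    ∀ x : ℝ, deriv F x = 0 →
      ∃ ε > 0, ∀ z : ℝ, 0 < |z - x| → |z - x| < ε → deriv F z ≠ 0 := by
  intro x _
  obtain ⟨k, hk1, hk⟩ := hnd x
  obtain ⟨k, rfl⟩ := Nat.exists_eq_add_of_le' hk1
  rw [iteratedDeriv_succ'] at hk
  exact exists_punctured_ball_ne_zero_of_iteratedDeriv_ne_zero k
    (contDiff_infty_iff_deriv.1 hF).2 hk
end

section
/- Let F : ℝ → ℝ be infinitely differentiable and 2π-periodic, and suppose that for every x ∈ ℝ there exists an integer k ≥ 1 such that the k-th derivative of F at x is nonzero. Then F has only finitely many critical points in the interval [0, 2π). -/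
open Real

open Filter Topology in
/-- Zeros of finite order of a smooth real function are isolated. -/
theorem eventually_ne_zero_of_iteratedDeriv_ne_zero {x : ℝ} (k : ℕ) {g : ℝ → ℝ}
    (hg : ContDiff ℝ (⊤ : ℕ∞) g) (hk : iteratedDeriv k g x ≠ 0) :
    ∀ᶠ y in 𝓝[≠] x, g y ≠ 0 := by
  induction k generalizing g with
  | zero =>
    rw [iteratedDeriv_zero] at hk
    exact (hg.continuous.continuousAt.eventually_ne hk).filter_mono nhdsWithin_le_nhds
  | succ k ih =>
    by_cases hx : g x = 0
    · rw [iteratedDeriv_succ'] at hk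
      have hderiv := ih (contDiff_infty_iff_deriv.1 hg).2 hk
      obtain ⟨ε, hε, hball⟩ := Metric.eventually_nhds_iff.1 (eventually_nhdsWithin_iff.1 hderiv)
      refine eventually_nhdsWithin_iff.2 (Metric.eventually_nhds_iff.2 ⟨ε, hε, ?_⟩)
      intro y hy hyx hgy
      rw [Real.dist_eq, abs_lt] at hy
      rcases lt_or_gt_of_ne hyx with h | h
      · obtain ⟨c, hc, hc0⟩ :=
          exists_deriv_eq_zero h hg.continuous.continuousOn (hgy.trans hx.symm)
        refine hball ?_ hc.2.ne hc0
        rw [Real.dist_eq, abs_lt]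
        constructor <;> linarith [hc.1, hc.2]
      · obtain ⟨c, hc, hc0⟩ :=
          exists_deriv_eq_zero h hg.continuous.continuousOn (hx.trans hgy.symm)
        refine hball ?_ hc.1.ne' hc0
        rw [Real.dist_eq, abs_lt]
        constructor <;> linarith [hc.1, hc.2]
    · exact (hg.continuous.continuousAt.eventually_ne hx).filter_mono nhdsWithin_le_nhds

/-- A smooth `2π`-periodic function all of whose points carry a nonzero derivative of
some order `k ≥ 1` has only finitely many critical points in `[0, 2π)`. -/
theorem finitely_many_critical_points
    (F : ℝ → ℝ) (hF : ContDiff ℝ (⊤ : ℕ∞) F)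
    (hper : Function.Periodic F (2 * π))
    (hnd : ∀ x : ℝ, ∃ k : ℕ, 1 ≤ k ∧ iteratedDeriv k F x ≠ 0) :
    {x ∈ Set.Ico (0 : ℝ) (2 * π) | deriv F x = 0}.Finite := by
  by_contra hinf
  obtain ⟨x, -, hacc⟩ := Set.Infinite.exists_accPt_of_subset_isCompact hinf
    (isCompact_Icc (a := (0 : ℝ)) (b := 2 * π)) fun y hy => Set.Ico_subset_Icc_self hy.1
  obtain ⟨k, hk1, hk⟩ := hnd x
  obtain ⟨k, rfl⟩ := Nat.exists_eq_add_of_le' hk1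
  rw [iteratedDeriv_succ'] at hk
  have hne := eventually_ne_zero_of_iteratedDeriv_ne_zero k (contDiff_infty_iff_deriv.1 hF).2 hk
  obtain ⟨y, hy, hy0⟩ := ((accPt_iff_frequently_nhdsNE.1 hacc).and_eventually hne).exists
  exact hy0 hy.2
end

section
/- Let x₀ < x < x₁ be real numbers with x₁ − x₀ ≤ 2π, let F : [x₀, x₁] → ℝ be differentiable and nondecreasing with F'(z) ≤ L for all z (where L > 0), let η > 0 and M > 0 satisfy M·η ≥ 1, F(x) − F(x₀) ≥ η and F(x₁) − F(x) ≥ η. Define p(y) = ∫_{x₀}^{y} e^{2M F(z)} dz. Then (p(x) − p(x₀)) / (p(x₁) − p(x₀)) ≤ 8 π M L e^{−2Mη}. -/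
open Real intervalIntegral

/-- Escape-probability bound via the scale function: if `F` is nondecreasing on
`[x₀, x₁]` with derivative bounded by `L`, `Mη ≥ 1`, and the level gaps
`F x - F x₀` and `F x₁ - F x` are at least `η`, then the scale-function ratio
is at most `8πML e^{-2Mη}`. -/
theorem scale_function_ratio_bound
    (x₀ x x₁ : ℝ) (h₀ : x₀ < x) (h₁ : x < x₁) (hlen : x₁ - x₀ ≤ 2 * π)
    (F F' : ℝ → ℝ)
    (hderiv : ∀ z ∈ Set.Icc x₀ x₁, HasDerivAt F (F' z) z)
    (hmono : MonotoneOn F (Set.Icc x₀ x₁))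
    (L : ℝ) (hL : 0 < L)
    (hF'L : ∀ z ∈ Set.Icc x₀ x₁, F' z ≤ L)
    (η M : ℝ) (hη : 0 < η) (hM : 0 < M) (hMη : 1 ≤ M * η)
    (hgap₀ : η ≤ F x - F x₀) (hgap₁ : η ≤ F x₁ - F x)
    (p : ℝ → ℝ)
    (hp : ∀ y : ℝ, p y = ∫ z in x₀..y, Real.exp (2 * M * F z)) :
    (p x - p x₀) / (p x₁ - p x₀) ≤ 8 * π * M * L * Real.exp (-2 * M * η) := by
  have hcF : ContinuousOn F (Set.Icc x₀ x₁) := fun z hz =>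
    (hderiv z hz).continuousAt.continuousWithinAt
  have hc : ContinuousOn (fun z => Real.exp (2 * M * F z)) (Set.Icc x₀ x₁) := by fun_prop
  have hi₀ : IntervalIntegrable (fun z => Real.exp (2 * M * F z)) MeasureTheory.volume x₀ x :=
    (hc.mono (Set.Icc_subset_Icc_right h₁.le)).intervalIntegrable_of_Icc h₀.le
  have hc₁ : ContinuousOn (fun z => Real.exp (2 * M * F z)) (Set.Icc x x₁) :=
    hc.mono (Set.Icc_subset_Icc_left h₀.le)
  have hi₁ : IntervalIntegrable (fun z => Real.exp (2 * M * F z)) MeasureTheory.volume x x₁ :=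
    hc₁.intervalIntegrable_of_Icc h₁.le
  have hp₀ : p x₀ = 0 := by rw [hp, integral_same]
  have hpx : 0 ≤ p x := by
    rw [hp]
    exact integral_nonneg h₀.le fun z _ => (Real.exp_pos _).le
  have hnum : p x ≤ 2 * π * Real.exp (2 * M * F x) := by
    have hle : p x ≤ ∫ _ in x₀..x, Real.exp (2 * M * F x) := by
      rw [hp]
      refine integral_mono_on h₀.le hi₀ intervalIntegrable_const fun z hz => ?_
      have := hmono ⟨hz.1, hz.2.trans h₁.le⟩ ⟨h₀.le, h₁.le⟩ hz.2
      gcongr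
    rw [integral_const, smul_eq_mul] at hle
    exact hle.trans (mul_le_mul_of_nonneg_right (by linarith) (Real.exp_pos _).le)
  have hsplit : p x₁ = p x + ∫ z in x..x₁, Real.exp (2 * M * F z) := by
    rw [hp, hp, integral_add_adjacent_intervals hi₀ hi₁]
  have htail : Real.exp (2 * M * F x₁) - Real.exp (2 * M * F x) ≤
      2 * M * L * ∫ z in x..x₁, Real.exp (2 * M * F z) := by
    rw [← integral_const_mul]
    refine sub_le_integral_of_hasDeriv_right_of_le h₁.le hc₁
      (g' := fun z => Real.exp (2 * M * F z) * (2 * M * F' z)) (fun z hz => ?_) ?_ fun z hz => ?_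
    · exact (((hderiv z ⟨h₀.le.trans hz.1.le, hz.2.le⟩).const_mul (2 * M)).exp).hasDerivWithinAt
    · exact (hc₁.const_mul (2 * M * L)).integrableOn_Icc
    · have := hF'L z ⟨h₀.le.trans hz.1.le, hz.2.le⟩
      calc Real.exp (2 * M * F z) * (2 * M * F' z)
          ≤ Real.exp (2 * M * F z) * (2 * M * L) := by gcongr
        _ = 2 * M * L * Real.exp (2 * M * F z) := mul_comm _ _
  set I := ∫ z in x..x₁, Real.exp (2 * M * F z)
  set a := Real.exp (2 * M * F x)
  set E := Real.exp (2 * M * η) with hE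
  have ha : 0 < a := Real.exp_pos _
  have hE₂ : 2 ≤ E := by
    have := Real.add_one_le_exp (2 * M * η)
    linarith
  have hgrow : a * E ≤ Real.exp (2 * M * F x₁) := by
    rw [← Real.exp_add, Real.exp_le_exp, ← mul_add]
    gcongr
    linarith
  have hI : a * E ≤ 4 * M * L * I := by nlinarith
  have hML : 0 < 4 * M * L := by positivity
  have hIpos : 0 < I := pos_of_mul_pos_right ((by positivity : 0 < a * E).trans_le hI) hML.le
  have hneg : Real.exp (-2 * M * η) = E⁻¹ := by
    rw [hE, ← Real.exp_neg]
    congr 1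
    ring
  rw [hp₀, sub_zero, sub_zero, hneg, div_le_iff₀ (by linarith), ← div_eq_mul_inv, div_mul_eq_mul_div,
    le_div_iff₀ (by linarith)]
  calc p x * E ≤ 2 * π * a * E := by gcongr
    _ = 2 * π * (a * E) := by ring
    _ ≤ 2 * π * (4 * M * L * I) := by gcongr
    _ = 8 * π * M * L * I := by ring
    _ ≤ 8 * π * M * L * p x₁ := by
      gcongr
      linarith
end

section
/- For j ∈ ℕ let η_j = min(4·ln(1+j)/(1+j), δ), where δ ∈ (0,1] is fixed, and let K > 0 be a constant. Then there exists M₀ ≥ 1 such that for every M ≥ M₀: (i) for every j ∈ ℕ, (K/√(η_j)) · (j + M) · e^{−(j+M) η_{j+1}} < 1, and (ii) the infinite product ∏_{j=0}^{∞} (1 − (K/√(η_j)) (j + M) e^{−(j+M) η_{j+1}}) is strictly positive. -/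
open Filter Topology in
theorem tendsto_mul_exp_neg_mul_atTop_nhds_zero {b : ℝ} (hb : 0 < b) :
    Tendsto (fun y : ℝ => y * Real.exp (-y * b)) atTop (𝓝 0) := by
  have h := ((Real.tendsto_pow_mul_exp_neg_atTop_nhds_zero 1).comp
    (tendsto_id.atTop_mul_const hb)).const_mul b⁻¹
  rw [mul_zero] at h
  refine h.congr fun y => ?_
  simp only [Function.comp_apply, id_eq, pow_one, neg_mul]
  field_simp

theorem div_le_min_log_div {δ : ℝ} (hδ0 : 0 < δ) (hδ1 : δ ≤ 1) {x : ℝ} (hx : 2 ≤ x) :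
    δ / x ≤ min (4 * Real.log x / x) δ := by
  have hlog : Real.log 2 ≤ Real.log x := Real.log_le_log (by norm_num) hx
  have := Real.log_two_gt_d9
  refine le_min ?_ (div_le_self hδ0.le (by linarith))
  gcongr
  linarith

theorem exp_neg_mul_min_log_div_le {δ : ℝ} (hδ0 : 0 < δ) (hδ1 : δ ≤ 1) {x : ℝ} (hx : 0 < x) :
    Real.exp (-x * min (4 * Real.log x / x) δ) ≤ 24 / (δ ^ 4 * x ^ 4) := by
  rcases min_choice (4 * Real.log x / x) δ with h | h <;> rw [h]
  · have hexp : Real.exp (-x * (4 * Real.log x / x)) = 1 / x ^ 4 := by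
      rw [show -x * (4 * Real.log x / x) = -((4 : ℕ) * Real.log x) by push_cast; field_simp,
        Real.exp_neg, Real.exp_nat_mul, Real.exp_log hx, one_div]
    rw [hexp, div_le_div_iff₀ (by positivity) (by positivity)]
    have : δ ^ 4 ≤ 1 := pow_le_one₀ hδ0.le hδ1
    nlinarith [pow_pos hx 4]
  · have h4 := Real.pow_div_factorial_le_exp (x * δ) (by positivity) 4
    rw [neg_mul, Real.exp_neg, ← inv_div]
    refine inv_anti₀ (by positivity) (le_trans (le_of_eq ?_) h4)
    norm_num [Nat.factorial]
    ring

theorem add_mul_exp_neg_add_mul_le {x t b c : ℝ} (hx : 0 ≤ x) (ht : 0 ≤ t) (hc : 0 < c)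
    (hc1 : c ≤ 1) (hb : c ≤ b * x) (hb0 : 0 < b) :
    (x + t) * Real.exp (-(x + t) * b) ≤ 2 * x / c * Real.exp (-x * b) := by
  have h1 : t * Real.exp (-(t * b)) ≤ x / c := by
    rw [Real.exp_neg, ← div_eq_mul_inv, div_le_div_iff₀ (Real.exp_pos _) hc]
    have := Real.add_one_le_exp (t * b)
    calc t * c ≤ t * (b * x) := by gcongr
      _ = x * (t * b) := by ring
      _ ≤ x * Real.exp (t * b) := by gcongr; linarith
  have h2 : x * Real.exp (-(t * b)) ≤ x / c := by
    have : Real.exp (-(t * b)) ≤ 1 := Real.exp_le_one_iff.2 (by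
      have := mul_nonneg ht hb0.le
      linarith)
    calc x * Real.exp (-(t * b)) ≤ x * 1 := by gcongr
      _ ≤ x / c := by rw [mul_one]; exact le_div_self hx hc hc1
  rw [show -(x + t) * b = -(t * b) + -x * b by ring, Real.exp_add, ← mul_assoc]
  gcongr
  calc (x + t) * Real.exp (-(t * b))
      = x * Real.exp (-(t * b)) + t * Real.exp (-(t * b)) := by ring
    _ ≤ x / c + x / c := add_le_add h2 h1
    _ = 2 * x / c := by ring

theorem multipliable_one_sub_and_tprod_pos {a : ℕ → ℝ} (hs : Summable a) (h1 : ∀ j, a j < 1) :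
    Multipliable (fun j => 1 - a j) ∧ 0 < ∏' j, (1 - a j) := by
  have hpos : ∀ j, 0 < 1 - a j := fun j => sub_pos.2 (h1 j)
  have hlog : Summable fun j => Real.log (1 - a j) := by
    simpa only [sub_eq_add_neg] using Real.summable_log_one_add_of_summable hs.neg
  refine ⟨Real.multipliable_of_summable_log hpos hlog, ?_⟩
  rw [← Real.rexp_tsum_eq_tprod hpos hlog]
  exact Real.exp_pos _

/-- For `M` large enough, each localization factor is positive and the infinite
product of `1 - (K/√η_j)(j+M)e^{-(j+M)η_{j+1}}` is strictly positive. -/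
theorem localization_infinite_product_positive
    (δ : ℝ) (hδ0 : 0 < δ) (hδ1 : δ ≤ 1)
    (η : ℕ → ℝ)
    (hη : ∀ j : ℕ, η j = min (4 * Real.log (1 + (j : ℝ)) / (1 + (j : ℝ))) δ)
    (K : ℝ) (hK : 0 < K) :
    ∃ M₀ : ℝ, 1 ≤ M₀ ∧ ∀ M : ℝ, M₀ ≤ M →
      (∀ j : ℕ,
        K / Real.sqrt (η j) * ((j : ℝ) + M) * Real.exp (-((j : ℝ) + M) * η (j + 1)) < 1) ∧
      Multipliable (fun j : ℕ =>
        1 - K / Real.sqrt (η j) * ((j : ℝ) + M) * Real.exp (-((j : ℝ) + M) * η (j + 1))) ∧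
      0 < ∏' j : ℕ,
        (1 - K / Real.sqrt (η j) * ((j : ℝ) + M) * Real.exp (-((j : ℝ) + M) * η (j + 1))) := by
  set a : ℝ → ℕ → ℝ := fun M j =>
    K / Real.sqrt (η j) * ((j : ℝ) + M) * Real.exp (-((j : ℝ) + M) * η (j + 1)) with ha
  have hη_succ : ∀ j : ℕ,
      η (j + 1) = min (4 * Real.log ((j : ℝ) + 2) / ((j : ℝ) + 2)) δ := fun j => by
    rw [hη, show (1 : ℝ) + ((j + 1 : ℕ) : ℝ) = (j : ℝ) + 2 by push_cast; ring]
  have hη_lower : ∀ j : ℕ, δ / ((j : ℝ) + 2) ≤ η (j + 1) := fun j => by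
    rw [hη_succ]
    exact div_le_min_log_div hδ0 hδ1 (by linarith [j.cast_nonneg (α := ℝ)])
  have hη_pos : ∀ j : ℕ, 0 < η (j + 1) := fun j => lt_of_lt_of_le (by positivity) (hη_lower j)
  have hcoef : ∀ j : ℕ, K / Real.sqrt (η j) ≤ K * ((j : ℝ) + 2) / δ := by
    rintro (_ | j)
    · have h0 : η 0 = 0 := by simp [hη, hδ0.le]
      rw [h0, Real.sqrt_zero, div_zero]
      positivity
    · have hle : δ / ((j : ℝ) + 2) ≤ Real.sqrt (η (j + 1)) := by
        refine Real.le_sqrt_of_sq_le (le_trans ?_ (hη_lower j))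
        refine pow_le_of_le_one (by positivity) ?_ two_ne_zero
        exact (div_le_one (by positivity)).2 (by linarith [j.cast_nonneg (α := ℝ)])
      calc K / Real.sqrt (η (j + 1)) ≤ K / (δ / ((j : ℝ) + 2)) := by gcongr
        _ = K * ((j : ℝ) + 2) / δ := by rw [div_div_eq_mul_div]
        _ ≤ K * (((j + 1 : ℕ) : ℝ) + 2) / δ := by gcongr; simp
  have ha_nonneg : ∀ M : ℝ, 2 ≤ M → ∀ j, 0 ≤ a M j := fun M hM j => by
    simp only [ha]
    positivity
  have ha_le : ∀ M : ℝ, 2 ≤ M → ∀ j : ℕ, a M j ≤ 48 * K / δ ^ 6 * (1 / ((j : ℝ) + 2) ^ 2) := by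
    intro M hM j
    have h1 := add_mul_exp_neg_add_mul_le (x := (j : ℝ) + 2) (t := M - 2) (by positivity)
      (by linarith) hδ0 hδ1 ((div_le_iff₀ (by positivity)).1 (hη_lower j)) (hη_pos j)
    rw [show (j : ℝ) + 2 + (M - 2) = j + M by ring] at h1
    have h2 := exp_neg_mul_min_log_div_le hδ0 hδ1 (x := (j : ℝ) + 2) (by positivity)
    rw [← hη_succ] at h2
    have hjM : 0 ≤ (j : ℝ) + M := by positivity
    calc a M j = K / Real.sqrt (η j) *
          (((j : ℝ) + M) * Real.exp (-((j : ℝ) + M) * η (j + 1))) := mul_assoc _ _ _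
      _ ≤ K * ((j : ℝ) + 2) / δ *
          (2 * ((j : ℝ) + 2) / δ * (24 / (δ ^ 4 * ((j : ℝ) + 2) ^ 4))) := by
        refine mul_le_mul (hcoef j) (h1.trans ?_) (by positivity) (by positivity)
        gcongr
      _ = 48 * K / δ ^ 6 * (1 / ((j : ℝ) + 2) ^ 2) := by
        field_simp
        norm_num
  have hbound : Summable fun j : ℕ => 48 * K / δ ^ 6 * (1 / ((j : ℝ) + 2) ^ 2) := by
    refine Summable.mul_left _ ?_
    have h := (summable_nat_add_iff 2).2 (Real.summable_one_div_nat_pow.2 one_lt_two)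
    simpa using h
  have ha_summable : ∀ M : ℝ, 2 ≤ M → Summable (a M) := fun M hM =>
    hbound.of_nonneg_of_le (ha_nonneg M hM) (ha_le M hM)
  have ha_tendsto : ∀ j, Filter.Tendsto (fun M => a M j) Filter.atTop (nhds 0) := fun j => by
    have h := ((tendsto_mul_exp_neg_mul_atTop_nhds_zero (hη_pos j)).comp
      (Filter.tendsto_atTop_add_const_left _ (j : ℝ) Filter.tendsto_id)).const_mul
        (K / Real.sqrt (η j))
    rw [mul_zero] at h
    exact h.congr fun M => (mul_assoc _ _ _).symm
  have hsum : Filter.Tendsto (fun M => ∑' j, a M j) Filter.atTop (nhds 0) := by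
    have h := tendsto_tsum_of_dominated_convergence hbound ha_tendsto (by
      filter_upwards [Filter.eventually_ge_atTop 2] with M hM j
      rw [Real.norm_of_nonneg (ha_nonneg M hM j)]
      exact ha_le M hM j)
    simpa using h
  obtain ⟨M₁, hM₁⟩ := Filter.eventually_atTop.1 (hsum.eventually_lt_const one_pos)
  refine ⟨max 2 M₁, le_max_of_le_left one_le_two, fun M hM => ?_⟩
  have hM2 : 2 ≤ M := (le_max_left _ _).trans hM
  have hlt : ∀ j, a M j < 1 := fun j =>
    ((ha_summable M hM2).le_tsum j fun i _ => ha_nonneg M hM2 i).trans_lt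
      (hM₁ M ((le_max_right _ _).trans hM))
  exact ⟨hlt, multipliable_one_sub_and_tprod_pos (ha_summable M hM2) hlt⟩
end

section
/- Let (Ω, F, (F_n)_{n∈ℕ}, P) be a filtered probability space, C > 0, and let (Z_n)_{n∈ℕ} be a nonnegative integrable adapted process satisfying E[Z_{n+1} | F_n] ≤ (1/2) Z_n + C almost surely for every n. Let n₀ = inf{n ∈ ℕ : Z_n ≤ 4C}. Then the stopped process ((4/3)^{n∧n₀} Z_{n∧n₀})_{n∈ℕ} is a supermartingale, P(n₀ > n) ≤ (3/4)^n E[Z₀]/(4C) for every n, and consequently n₀ is almost surely finite and E[λ^{n₀}] < ∞ for every λ ∈ (1, 4/3). -/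
open MeasureTheory Filter

section HittingTime

variable {Ω : Type*} {Z : ℕ → Ω → ℝ} {c : ℝ} {τ : Ω → ℕ∞}

lemma coe_lt_hitting_iff (hτ : ∀ ω, τ ω = ⨅ (n : ℕ) (_ : Z n ω ≤ c), (n : ℕ∞)) (n : ℕ) (ω : Ω) :
    (n : ℕ∞) < τ ω ↔ ∀ k ≤ n, c < Z k ω := by
  rw [hτ]
  constructor
  · intro h k hk
    by_contra! hZ
    have : (⨅ (n : ℕ) (_ : Z n ω ≤ c), (n : ℕ∞)) ≤ (k : ℕ∞) := iInf₂_le k hZ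
    exact absurd (h.trans_le this) (not_lt.2 (by exact_mod_cast hk))
  · intro h
    refine lt_of_lt_of_le (b := ((n + 1 : ℕ) : ℕ∞)) (by exact_mod_cast n.lt_succ_self) ?_
    refine le_iInf₂ fun k hk => ?_
    by_contra! hlt
    have hkn : k < n + 1 := by exact_mod_cast hlt
    exact (h k (by omega)).not_ge hk

lemma measurableSet_coe_lt_hitting {m0 : MeasurableSpace Ω} {ℱ : Filtration ℕ m0}
    (hZ : Adapted ℱ Z) (hτ : ∀ ω, τ ω = ⨅ (n : ℕ) (_ : Z n ω ≤ c), (n : ℕ∞)) (n : ℕ) :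
    MeasurableSet[ℱ n] {ω | (n : ℕ∞) < τ ω} := by
  have h : {ω | (n : ℕ∞) < τ ω} = ⋂ k ∈ Set.Iic n, {ω | c < Z k ω} := by
    ext ω
    simp [coe_lt_hitting_iff hτ]
  rw [h]
  refine MeasurableSet.biInter (Set.to_countable _) fun k hk => ℱ.mono hk _ ?_
  exact hZ k measurableSet_Ioi

end HittingTime

lemma stopped_succ {Ω : Type*} (u : ℕ → Ω → ℝ) (τ : Ω → ℕ∞) (n : ℕ) (ω : Ω) :
    u ((min ((n + 1 : ℕ) : ℕ∞) (τ ω)).toNat) ω =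
      u ((min (n : ℕ∞) (τ ω)).toNat) ω +
        {ω | (n : ℕ∞) < τ ω}.indicator (u (n + 1) - u n) ω := by
  by_cases h : (n : ℕ∞) < τ ω
  · have h' : ((n + 1 : ℕ) : ℕ∞) ≤ τ ω := by
      push_cast
      exact Order.add_one_le_of_lt h
    rw [min_eq_left h.le, min_eq_left h', ENat.toNat_natCast, ENat.toNat_natCast,
      Set.indicator_of_mem (by exact h)]
    simp
  · have h' : τ ω ≤ n := not_lt.1 h
    rw [min_eq_right h', min_eq_right (h'.trans (by exact_mod_cast n.le_succ)),
      Set.indicator_of_notMem (by exact h), add_zero]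

lemma supermartingale_stopped_of_condExp_le {Ω : Type*} {m0 : MeasurableSpace Ω} {μ : Measure Ω}
    [IsFiniteMeasure μ] {ℱ : Filtration ℕ m0} {u : ℕ → Ω → ℝ} {τ : Ω → ℕ∞}
    (hadp : StronglyAdapted ℱ u) (hint : ∀ n, Integrable (u n) μ)
    (hτ : ∀ n : ℕ, MeasurableSet[ℱ n] {ω | (n : ℕ∞) < τ ω})
    (hle : ∀ n : ℕ, ∀ᵐ ω ∂μ, (n : ℕ∞) < τ ω → (μ[u (n + 1) | ℱ n]) ω ≤ u n ω) :
    Supermartingale (fun (n : ℕ) ω => u ((min (n : ℕ∞) (τ ω)).toNat) ω) ℱ μ := by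
  have hsucc (n : ℕ) : (fun ω => u ((min ((n + 1 : ℕ) : ℕ∞) (τ ω)).toNat) ω) =
      (fun ω => u ((min (n : ℕ∞) (τ ω)).toNat) ω) +
        {ω | (n : ℕ∞) < τ ω}.indicator (u (n + 1) - u n) :=
    funext fun ω => stopped_succ u τ n ω
  refine supermartingale_of_condExp_sub_nonneg_nat (fun n => ?_) (fun n => ?_) fun n => ?_
  · induction n with
    | zero => simpa using hadp 0
    | succ n ih =>
      rw [hsucc]
      exact (ih.mono (ℱ.mono n.le_succ)).add
        (((hadp (n + 1)).sub ((hadp n).mono (ℱ.mono n.le_succ))).indicator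
          (ℱ.mono n.le_succ _ (hτ n)))
  · induction n with
    | zero => simpa using hint 0
    | succ n ih =>
      rw [hsucc]
      exact ih.add (((hint (n + 1)).sub (hint n)).indicator (ℱ.le n _ (hτ n)))
  · have hdiff : (fun ω => u ((min (n : ℕ∞) (τ ω)).toNat) ω) -
        (fun ω => u ((min ((n + 1 : ℕ) : ℕ∞) (τ ω)).toNat) ω) =
        {ω | (n : ℕ∞) < τ ω}.indicator (u n - u (n + 1)) := by
      rw [hsucc, sub_add_cancel_left, ← Set.indicator_neg', neg_sub]
    rw [hdiff]
    filter_upwards [condExp_indicator ((hint n).sub (hint (n + 1))) (hτ n),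
      condExp_sub (hint n) (hint (n + 1)) (ℱ n), hle n] with ω h₁ h₂ h₃
    rw [h₁]
    refine Set.indicator_apply_nonneg fun hω => ?_
    rw [h₂, Pi.sub_apply, condExp_of_stronglyMeasurable (ℱ.le n) (hadp n) (hint n), sub_nonneg]
    exact h₃ hω

lemma measurable_toNat_of_coe_lt {Ω : Type*} [MeasurableSpace Ω] {τ : Ω → ℕ∞}
    (hτ : ∀ n : ℕ, MeasurableSet {ω | (n : ℕ∞) < τ ω}) : Measurable fun ω => (τ ω).toNat := by
  have htop : MeasurableSet {ω | τ ω = ⊤} := by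
    have h : {ω | τ ω = ⊤} = ⋂ n : ℕ, {ω | (n : ℕ∞) < τ ω} := by
      ext ω
      simp [ENat.eq_top_iff_forall_gt]
    rw [h]
    exact MeasurableSet.iInter hτ
  refine measurable_of_Ioi fun n => ?_
  have h : (fun ω => (τ ω).toNat) ⁻¹' Set.Ioi n = {ω | (n : ℕ∞) < τ ω} \ {ω | τ ω = ⊤} := by
    ext ω
    simp only [Set.mem_preimage, Set.mem_Ioi, Set.mem_sdiff, Set.mem_ofPred_eq]
    induction τ ω using ENat.recTopCoe <;> simp
  rw [h]
  exact (hτ n).diff htop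

lemma integrable_pow_toNat_of_geometric_tail {Ω : Type*} [MeasurableSpace Ω] {μ : Measure Ω}
    [IsFiniteMeasure μ] {τ : Ω → ℕ∞} (hτ : ∀ n : ℕ, MeasurableSet {ω | (n : ℕ∞) < τ ω})
    {r K l : ℝ} (hr : 0 ≤ r) (hl : 0 ≤ l) (hlr : l * r < 1)
    (htail : ∀ n : ℕ, μ {ω | (n : ℕ∞) < τ ω} ≤ ENNReal.ofReal (r ^ n * K)) :
    Integrable (fun ω => l ^ (τ ω).toNat) μ := by
  have hmeas : Measurable fun ω => l ^ (τ ω).toNat :=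
    (measurable_from_nat (f := fun k : ℕ => l ^ k)).comp (measurable_toNat_of_coe_lt hτ)
  refine ⟨hmeas.aestronglyMeasurable, ?_⟩
  rw [hasFiniteIntegral_iff_ofReal (ae_of_all _ fun ω => pow_nonneg hl _)]
  have hbound (ω : Ω) : ENNReal.ofReal (l ^ (τ ω).toNat) ≤
      1 + ∑' n : ℕ, {ω | (n : ℕ∞) < τ ω}.indicator (fun _ => ENNReal.ofReal (l ^ (n + 1))) ω := by
    rcases h : (τ ω).toNat with _ | k
    · simp
    · have hk : (k : ℕ∞) < τ ω := by
        rw [← ENat.natCast_toNat (n := τ ω) (by rintro h'; simp [h'] at h), h]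
        exact_mod_cast k.lt_succ_self
      refine le_trans ?_ (le_add_of_nonneg_left zero_le_one)
      refine le_trans (Eq.ge ?_) (ENNReal.le_tsum k)
      exact Set.indicator_of_mem (s := {ω | (k : ℕ∞) < τ ω}) hk _
  refine (lintegral_mono hbound).trans_lt ?_
  rw [lintegral_add_left measurable_const, lintegral_tsum fun n =>
    (measurable_const.indicator (hτ n)).aemeasurable]
  refine ENNReal.add_lt_top.2 ⟨by simp, ?_⟩
  have hsum : Summable fun n : ℕ => l * |K| * (l * r) ^ n :=
    (summable_geometric_of_lt_one (mul_nonneg hl hr) hlr).mul_left _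
  refine lt_of_le_of_lt (ENNReal.tsum_le_tsum fun n => ?_) hsum.tsum_ofReal_lt_top
  rw [lintegral_indicator_const (hτ n)]
  calc ENNReal.ofReal (l ^ (n + 1)) * μ {ω | (n : ℕ∞) < τ ω}
      ≤ ENNReal.ofReal (l ^ (n + 1)) * ENNReal.ofReal (r ^ n * |K|) := by
        gcongr
        exact (htail n).trans (ENNReal.ofReal_le_ofReal (by gcongr; exact le_abs_self K))
    _ = ENNReal.ofReal (l * |K| * (l * r) ^ n) := by
        rw [← ENNReal.ofReal_mul (pow_nonneg hl _)]
        congr 1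
        ring

lemma ae_lt_top_of_geometric_tail {Ω : Type*} [MeasurableSpace Ω] {μ : Measure Ω}
    {τ : Ω → ℕ∞} {r K : ℝ} (hr : 0 ≤ r) (hr1 : r < 1)
    (htail : ∀ n : ℕ, μ {ω | (n : ℕ∞) < τ ω} ≤ ENNReal.ofReal (r ^ n * K)) :
    ∀ᵐ ω ∂μ, τ ω < ⊤ := by
  have hlim : Tendsto (fun n : ℕ => ENNReal.ofReal (r ^ n * K)) atTop (nhds 0) := by
    have h := (tendsto_pow_atTop_nhds_zero_of_lt_one hr hr1).mul_const K
    rw [zero_mul] at h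
    simpa using ENNReal.tendsto_ofReal h
  refine le_antisymm (ge_of_tendsto' hlim fun n => (measure_mono fun ω hω => ?_).trans (htail n))
    zero_le
  have hω' : τ ω = ⊤ := not_lt_top_iff.1 hω
  simp [hω']

/-- A geometric drift condition `E[Z_{n+1}|F_n] ≤ Z_n/2 + C` implies that the
hitting time `n₀` of `{Z ≤ 4C}` is a.s. finite with geometric moments, via the
supermartingale `(4/3)^{n∧n₀} Z_{n∧n₀}`. -/
theorem drift_implies_geometric_return_time
    {Ω : Type*} {m0 : MeasurableSpace Ω} {μ : Measure Ω} [IsProbabilityMeasure μ]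
    (ℱ : Filtration ℕ m0) (C : ℝ) (hC : 0 < C)
    (Z : ℕ → Ω → ℝ)
    (hadapted : Adapted ℱ Z)
    (hint : ∀ n, Integrable (Z n) μ)
    (hnn : ∀ n ω, 0 ≤ Z n ω)
    (hdrift : ∀ n, ∀ᵐ ω ∂μ, (μ[Z (n + 1) | ℱ n]) ω ≤ (1 / 2) * Z n ω + C)
    (n₀ : Ω → ℕ∞)
    (hn₀ : ∀ ω, n₀ ω = ⨅ (n : ℕ) (_ : Z n ω ≤ 4 * C), (n : ℕ∞)) :
    Supermartingale
      (fun (n : ℕ) ω => (4 / 3 : ℝ) ^ ((min (n : ℕ∞) (n₀ ω)).toNat)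
        * Z ((min (n : ℕ∞) (n₀ ω)).toNat) ω) ℱ μ ∧
    (∀ n : ℕ, μ {ω | (n : ℕ∞) < n₀ ω}
        ≤ ENNReal.ofReal ((3 / 4 : ℝ) ^ n * (∫ ω, Z 0 ω ∂μ) / (4 * C))) ∧
    (∀ᵐ ω ∂μ, n₀ ω < ⊤) ∧
    (∀ l : ℝ, 1 < l → l < 4 / 3 → Integrable (fun ω => l ^ (n₀ ω).toNat) μ) := by
  have hmeas := measurableSet_coe_lt_hitting hadapted hn₀
  have hsuper : Supermartingale
      (fun (n : ℕ) ω => (4 / 3 : ℝ) ^ ((min (n : ℕ∞) (n₀ ω)).toNat)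
        * Z ((min (n : ℕ∞) (n₀ ω)).toNat) ω) ℱ μ := by
    refine supermartingale_stopped_of_condExp_le (u := fun n ω => (4 / 3 : ℝ) ^ n * Z n ω)
      (fun n => ((hadapted n).const_mul _).stronglyMeasurable)
      (fun n => (hint n).const_mul _) hmeas fun n => ?_
    filter_upwards [hdrift n, condExp_smul (μ := μ) ((4 / 3 : ℝ) ^ (n + 1)) (Z (n + 1)) (ℱ n)]
      with ω hω hsmul hlt
    have hZ := (coe_lt_hitting_iff hn₀ n ω).1 hlt n le_rfl
    have hstep : (μ[Z (n + 1) | ℱ n]) ω ≤ (3 / 4) * Z n ω := by linarith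
    calc (μ[fun ω => (4 / 3 : ℝ) ^ (n + 1) * Z (n + 1) ω | ℱ n]) ω
        = (4 / 3 : ℝ) ^ (n + 1) * (μ[Z (n + 1) | ℱ n]) ω := hsmul
      _ ≤ (4 / 3 : ℝ) ^ (n + 1) * ((3 / 4) * Z n ω) := by gcongr
      _ = (4 / 3 : ℝ) ^ n * Z n ω := by ring
  have htail (n : ℕ) : μ {ω | (n : ℕ∞) < n₀ ω}
      ≤ ENNReal.ofReal ((3 / 4 : ℝ) ^ n * (∫ ω, Z 0 ω ∂μ) / (4 * C)) := by
    have hmean := hsuper.setIntegral_le n.zero_le MeasurableSet.univ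
    simp only [Measure.restrict_univ, Nat.cast_zero, zero_min, ENat.toNat_zero, pow_zero,
      one_mul] at hmean
    have hmarkov := mul_meas_ge_le_integral_of_nonneg
      (ae_of_all μ fun ω => mul_nonneg (by positivity) (hnn _ ω)) (hsuper.integrable n)
      ((4 / 3 : ℝ) ^ n * (4 * C))
    have hsub : μ.real {ω | (n : ℕ∞) < n₀ ω} ≤ μ.real {ω | (4 / 3 : ℝ) ^ n * (4 * C) ≤
        (4 / 3 : ℝ) ^ ((min (n : ℕ∞) (n₀ ω)).toNat) * Z ((min (n : ℕ∞) (n₀ ω)).toNat) ω} := by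
      refine measureReal_mono fun ω (hω : (n : ℕ∞) < n₀ ω) => ?_
      have hZ := (coe_lt_hitting_iff hn₀ n ω).1 hω n le_rfl
      simp only [Set.mem_ofPred_eq, min_eq_left hω.le, ENat.toNat_natCast]
      gcongr
    rw [← ofReal_measureReal]
    refine ENNReal.ofReal_le_ofReal ?_
    have hone : (3 / 4 : ℝ) ^ n * (4 / 3) ^ n = 1 := by
      rw [← mul_pow]
      norm_num
    rw [le_div_iff₀ (by positivity)]
    calc μ.real {ω | (n : ℕ∞) < n₀ ω} * (4 * C)
        = (3 / 4 : ℝ) ^ n * ((4 / 3) ^ n * (4 * C) * μ.real {ω | (n : ℕ∞) < n₀ ω}) := by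
          linear_combination -(μ.real {ω | (n : ℕ∞) < n₀ ω} * (4 * C)) * hone
      _ ≤ (3 / 4 : ℝ) ^ n * ∫ ω, Z 0 ω ∂μ := by
          refine mul_le_mul_of_nonneg_left ?_ (by positivity)
          exact (mul_le_mul_of_nonneg_left hsub (by positivity)).trans (hmarkov.trans hmean)
  have htail' (n : ℕ) : μ {ω | (n : ℕ∞) < n₀ ω}
      ≤ ENNReal.ofReal ((3 / 4 : ℝ) ^ n * ((∫ ω, Z 0 ω ∂μ) / (4 * C))) := by
    rw [← mul_div_assoc]
    exact htail n
  exact ⟨hsuper, htail, ae_lt_top_of_geometric_tail (by norm_num) (by norm_num) htail',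
    fun l hl1 hl2 => integrable_pow_toNat_of_geometric_tail (fun n => ℱ.le n _ (hmeas n))
      (by norm_num) (by linarith) (by linarith) htail'⟩
end

section
/- Let F : ℝ → ℝ be infinitely differentiable. Define the smooth vector fields G₀ and G₁ on ℝ² (with coordinates (x,u)) by G₀(x,u) = (1, 0) and G₁(x,u) = (−u F'(x), F(x)). Then for every k ≥ 0, the k-fold iterated Lie bracket [G₀,[G₀, …, [G₀, G₁] … ]] (with G₀ appearing k times) is the vector field (x,u) ↦ (−u F^{(k+1)}(x), F^{(k)}(x)). -/
open Real

/-- Lie bracket of two vector fields on `ℝ²`: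
`[V, W](z) = DW(z)·V(z) − DV(z)·W(z)`. -/
noncomputable def lieBracket (V W : ℝ × ℝ → ℝ × ℝ) : ℝ × ℝ → ℝ × ℝ :=
  fun z => fderiv ℝ W z (V z) - fderiv ℝ V z (W z)

/-- Bracketing with the constant field `(1, 0)` differentiates in the first coordinate. -/
theorem lieBracket_const_left {f g : ℝ → ℝ} (hf : Differentiable ℝ f) (hg : Differentiable ℝ g) :
    lieBracket (fun _ : ℝ × ℝ => ((1 : ℝ), (0 : ℝ))) (fun p : ℝ × ℝ => (-p.2 * f p.1, g p.1))
      = fun p : ℝ × ℝ => (-p.2 * deriv f p.1, deriv g p.1) := by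
  funext z
  have hf' := (hf z.1).hasDerivAt.comp_hasFDerivAt z (hasFDerivAt_fst (𝕜 := ℝ) (p := z))
  have hg' := (hg z.1).hasDerivAt.comp_hasFDerivAt z (hasFDerivAt_fst (𝕜 := ℝ) (p := z))
  have h := (hasFDerivAt_snd.neg.mul hf').prodMk hg'
  have h' : fderiv ℝ (fun p : ℝ × ℝ => (-p.2 * f p.1, g p.1)) z = _ := h.fderiv
  rw [lieBracket, h']
  simp

/-- The iterated Lie brackets `[G₀,[G₀,…,[G₀,G₁]…]]` (with `G₀` appearing `k`
times) of `G₀(x,u) = (1,0)` with `G₁(x,u) = (−u F'(x), F(x))` are the vector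
fields `(x,u) ↦ (−u F^{(k+1)}(x), F^{(k)}(x))`. -/
theorem iterated_lie_brackets
    (F : ℝ → ℝ) (hF : ContDiff ℝ (⊤ : ℕ∞) F) :
    ∀ k : ℕ,
      (lieBracket (fun _ : ℝ × ℝ => ((1 : ℝ), (0 : ℝ))))^[k]
          (fun p : ℝ × ℝ => (-p.2 * deriv F p.1, F p.1))
        = fun p : ℝ × ℝ => (-p.2 * iteratedDeriv (k + 1) F p.1, iteratedDeriv k F p.1) := by
  intro k
  have hd : ∀ n : ℕ, Differentiable ℝ (iteratedDeriv n F) := fun n =>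
    hF.differentiable_iteratedDeriv n (by exact_mod_cast WithTop.coe_lt_top n)
  induction k with
  | zero => simp [iteratedDeriv_one]
  | succ k ih =>
    rw [Function.iterate_succ_apply', ih, lieBracket_const_left (hd (k + 1)) (hd k)]
    simp only [iteratedDeriv_succ]
end

section
/- Let F : ℝ → ℝ be infinitely differentiable and suppose that for every x ∈ ℝ there exists an integer k ≥ 1 with F^{(k)}(x) ≠ 0. Define the vector fields G₀(x,u) = (1, 0) and G₁(x,u) = (−u F'(x), F(x)) on ℝ². Then for every (x,u) ∈ ℝ², the linear span of the set of vectors {G₀(x,u)} ∪ { (−u F^{(k+1)}(x), F^{(k)}(x)) : k ≥ 0 } is all of ℝ². In other words, the Hörmander bracket condition holds at every point for the SDE dX = dB − U F'(X) dt, dU = F(X) dt, since the iterated Lie brackets of G₀ with G₁ are exactly the vector fields (x,u) ↦ (−u F^{(k+1)}(x), F^{(k)}(x)). -/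
open Real

/-- The bracket of the horizontal unit field with `V` is the partial derivative of `V` in the
first variable. -/
theorem lieBracket_const_eq_of_hasDerivAt {V DV : ℝ × ℝ → ℝ × ℝ}
    (hV : Differentiable ℝ V)
    (h : ∀ x u : ℝ, HasDerivAt (fun t => V (t, u)) (DV (x, u)) x) :
    lieBracket (fun _ : ℝ × ℝ => ((1 : ℝ), (0 : ℝ))) V = DV := by
  funext ⟨x, u⟩
  have hline : HasDerivAt (fun t : ℝ => (t, u)) ((1 : ℝ), (0 : ℝ)) x :=
    (hasDerivAt_id x).prodMk (hasDerivAt_const x u)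
  have hcomp := (hV (x, u)).hasFDerivAt.comp_hasDerivAt x hline
  simpa [lieBracket] using hcomp.unique (h x u)

theorem ContDiff.hasDerivAt_iteratedDeriv {F : ℝ → ℝ} (hF : ContDiff ℝ (⊤ : ℕ∞) F) (k : ℕ)
    (x : ℝ) : HasDerivAt (iteratedDeriv k F) (iteratedDeriv (k + 1) F x) x := by
  rw [iteratedDeriv_succ]
  exact (hF.differentiable_iteratedDeriv k (by exact_mod_cast ENat.natCast_lt_top k) x).hasDerivAt

/-- Hörmander bracket condition for the self-interacting diffusion: the iterated
Lie brackets of `G₀(x,u) = (1,0)` with `G₁(x,u) = (−u F'(x), F(x))` are the fields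
`(x,u) ↦ (−u F^{(k+1)}(x), F^{(k)}(x))`, and together with `G₀` they span `ℝ²`
at every point, provided some derivative of `F` of order `≥ 1` is nonzero at
every point. -/
theorem hormander_condition
    (F : ℝ → ℝ) (hF : ContDiff ℝ (⊤ : ℕ∞) F)
    (hnd : ∀ x : ℝ, ∃ k : ℕ, 1 ≤ k ∧ iteratedDeriv k F x ≠ 0) :
    (∀ k : ℕ,
      (lieBracket (fun _ : ℝ × ℝ => ((1 : ℝ), (0 : ℝ))))^[k]
          (fun p : ℝ × ℝ => (-p.2 * deriv F p.1, F p.1))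
        = fun p : ℝ × ℝ => (-p.2 * iteratedDeriv (k + 1) F p.1, iteratedDeriv k F p.1)) ∧
    (∀ x u : ℝ,
      Submodule.span ℝ
        ({((1 : ℝ), (0 : ℝ))} ∪
          {v : ℝ × ℝ | ∃ k : ℕ, v = (-u * iteratedDeriv (k + 1) F x, iteratedDeriv k F x)})
        = (⊤ : Submodule ℝ (ℝ × ℝ))) := by
  refine ⟨fun k => ?_, fun x u => ?_⟩
  · induction k with
    | zero => simp
    | succ k ih =>
      rw [Function.iterate_succ_apply', ih]
      have hdiff (j : ℕ) : Differentiable ℝ (iteratedDeriv j F) := fun x =>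
        (hF.hasDerivAt_iteratedDeriv j x).differentiableAt
      refine lieBracket_const_eq_of_hasDerivAt ?_ fun x u => ?_
      · exact (differentiable_snd.neg.mul ((hdiff (k + 1)).comp differentiable_fst)).prodMk
          ((hdiff k).comp differentiable_fst)
      · exact ((hF.hasDerivAt_iteratedDeriv (k + 1) x).const_mul (-u)).prodMk
          (hF.hasDerivAt_iteratedDeriv k x)
  · obtain ⟨k, -, hk⟩ := hnd x
    rw [eq_top_iff]
    rintro ⟨a, b⟩ -
    set c := b / iteratedDeriv k F x with hc
    have hab : ((a, b) : ℝ × ℝ) = (a + c * (u * iteratedDeriv (k + 1) F x)) • ((1 : ℝ), (0 : ℝ)) +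
        c • (-u * iteratedDeriv (k + 1) F x, iteratedDeriv k F x) := by
      ext
      · simp
      · simp [hc, hk]
    rw [hab]
    exact add_mem (Submodule.smul_mem _ _ (Submodule.subset_span (Or.inl rfl)))
      (Submodule.smul_mem _ _ (Submodule.subset_span (Or.inr ⟨k, rfl⟩)))
end

section
/- Let F : ℝ → ℝ be infinitely differentiable, 2π-periodic, and attain both strictly positive and strictly negative values. Then for all x₀, x₁, u₀, u₁ ∈ ℝ there exists t₀ > 0 such that for every t ≥ t₀ there exist a finite subdivision 0 = s₀ < s₁ < … < s_n = t and velocities y₁, …, y_n ∈ {−1, 0, 1} so that the continuous, piecewise affine path x : [0,t] → ℝ defined by x(0) = x₀ and x'(s) = y_i for s ∈ (s_{i−1}, s_i), together with u(t) = u₀ + ∫₀ᵗ F(x(s)) ds, satisfies x(t) − x₁ ∈ 2πℤ and u(t) = u₁. -/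
open Real intervalIntegral

/-- A translate of `y` by whole periods of `F` that lies beyond `z`. -/
lemma exists_gt_add_int_mul_eq {F : ℝ → ℝ} (hper : Function.Periodic F (2 * π)) (z y : ℝ) :
    ∃ w > z, (∃ m : ℤ, w = y + 2 * π * m) ∧ F w = F y := by
  obtain ⟨n, hn⟩ := exists_nat_gt ((z - y) / (2 * π))
  rw [div_lt_iff₀ two_pi_pos] at hn
  exact ⟨y + n * (2 * π), by linarith, ⟨n, by push_cast; ring⟩, hper.nat_mul n y⟩

/-- Positive waiting times of prescribed sum and prescribed weighted sum. -/
lemma exists_pos_weights {α β T C : ℝ} (hα : 0 < α) (hβ : β < 0)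
    (hT : |C| / α + |C| / (-β) < T) :
    ∃ p q : ℝ, 0 < p ∧ 0 < q ∧ p + q = T ∧ p * α + q * β = C := by
  have hβ' : 0 < -β := neg_pos.2 hβ
  have h1 : |C| < T * α := by
    rw [← div_lt_iff₀ hα]
    linarith [div_nonneg (abs_nonneg C) hβ'.le]
  have h2 : |C| < T * -β := by
    rw [← div_lt_iff₀ hβ']
    linarith [div_nonneg (abs_nonneg C) hα.le]
  have hαβ : 0 < α - β := by linarith
  refine ⟨(C - T * β) / (α - β), (T * α - C) / (α - β), div_pos ?_ hαβ, div_pos ?_ hαβ, ?_, ?_⟩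
  · linarith [neg_abs_le C]
  · linarith [le_abs_self C]
  · field_simp
    ring
  · field_simp
    ring

/-- The unit speed path from `x₀` that pauses at `a` for time `p` and at `b` for time `q`. -/
noncomputable def pausedPath (x₀ a b p q s : ℝ) : ℝ :=
  min (x₀ + s) (max a (min (x₀ - p + s) (max b (x₀ - p - q + s))))

lemma continuous_pausedPath (x₀ a b p q : ℝ) : Continuous (pausedPath x₀ a b p q) := by
  unfold pausedPath
  fun_prop

section pausedPath

variable {x₀ a b c p q s : ℝ}

lemma pausedPath_of_le_fst (hs : s ≤ a - x₀) :
    pausedPath x₀ a b p q s = x₀ + s :=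
  min_eq_left (le_max_of_le_left (by linarith))

lemma pausedPath_of_mem_fst_pause (h1 : a - x₀ ≤ s) (h2 : s ≤ a - x₀ + p) :
    pausedPath x₀ a b p q s = a := by
  rw [pausedPath, max_eq_left (min_le_of_left_le (by linarith)), min_eq_right (by linarith)]

lemma pausedPath_of_mem_between (hp : 0 ≤ p) (h1 : a - x₀ + p ≤ s)
    (h2 : s ≤ b - x₀ + p) : pausedPath x₀ a b p q s = x₀ - p + s := by
  rw [pausedPath, min_eq_left (b := max b _) (le_max_of_le_left (by linarith)),
    max_eq_right (by linarith), min_eq_right (by linarith)]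

lemma pausedPath_of_mem_snd_pause (hab : a ≤ b) (hp : 0 ≤ p) (h1 : b - x₀ + p ≤ s)
    (h2 : s ≤ b - x₀ + p + q) : pausedPath x₀ a b p q s = b := by
  rw [pausedPath, max_eq_left (a := b) (by linarith), min_eq_right (b := b) (by linarith),
    max_eq_right hab, min_eq_right (by linarith)]

lemma pausedPath_of_snd_le (hab : a ≤ b) (hp : 0 ≤ p) (hq : 0 ≤ q)
    (hs : b - x₀ + p + q ≤ s) : pausedPath x₀ a b p q s = x₀ - p - q + s := by
  rw [pausedPath, max_eq_right (a := b) (by linarith), min_eq_right (a := x₀ - p + s) (by linarith),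
    max_eq_right (by linarith), min_eq_right (by linarith)]

lemma integral_comp_pausedPath {F : ℝ → ℝ} (hF : Continuous F) (ha : x₀ ≤ a) (hab : a ≤ b)
    (hbc : b ≤ c) (hp : 0 ≤ p) (hq : 0 ≤ q) :
    ∫ s in (0 : ℝ)..(c - x₀ + p + q), F (pausedPath x₀ a b p q s) =
      (∫ s in x₀..c, F s) + (p * F a + q * F b) := by
  have hint : ∀ l r, IntervalIntegrable (fun s => F (pausedPath x₀ a b p q s))
      MeasureTheory.volume l r :=
    fun l r => (hF.comp (continuous_pausedPath ..)).intervalIntegrable l r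
  have key : ∀ {l r : ℝ} {f : ℝ → ℝ}, l ≤ r →
      Set.EqOn (pausedPath x₀ a b p q) f (Set.Icc l r) →
      ∫ s in l..r, F (pausedPath x₀ a b p q s) = ∫ s in l..r, F (f s) := by
    intro l r f hlr h
    refine integral_congr fun s hs => ?_
    rw [Set.uIcc_of_le hlr] at hs
    exact congrArg F (h hs)
  rw [← integral_add_adjacent_intervals (hint 0 (a - x₀)) (hint _ _),
    ← integral_add_adjacent_intervals (hint (a - x₀) (a - x₀ + p)) (hint _ _),
    ← integral_add_adjacent_intervals (hint (a - x₀ + p) (b - x₀ + p)) (hint _ _),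
    ← integral_add_adjacent_intervals (hint (b - x₀ + p) (b - x₀ + p + q)) (hint _ _),
    key (by linarith) fun r hr => pausedPath_of_le_fst hr.2,
    key (by linarith) fun r hr => pausedPath_of_mem_fst_pause hr.1 hr.2,
    key (by linarith) fun r hr => pausedPath_of_mem_between hp hr.1 hr.2,
    key (by linarith) fun r hr => pausedPath_of_mem_snd_pause hab hp hr.1 hr.2,
    key (by linarith) fun r hr => pausedPath_of_snd_le hab hp hq hr.1,
    integral_comp_add_left F, integral_comp_add_left F, integral_comp_add_left F,
    integral_const, integral_const,
    ← integral_add_adjacent_intervals (hF.intervalIntegrable x₀ a) (hF.intervalIntegrable a c),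
    ← integral_add_adjacent_intervals (hF.intervalIntegrable a b) (hF.intervalIntegrable b c)]
  ring_nf

end pausedPath

/-- Controllability for the velocity jump process on the circle: with piecewise
constant velocities in `{−1, 0, 1}`, from any `(x₀, u₀)` one can reach any
`(x₁, u₁)` (position modulo `2π`) in any sufficiently large time `t`. -/
theorem velocity_jump_controllability
    (F : ℝ → ℝ) (hF : ContDiff ℝ (⊤ : ℕ∞) F)
    (hper : Function.Periodic F (2 * π))
    (hpos : ∃ a : ℝ, 0 < F a) (hneg : ∃ b : ℝ, F b < 0) :
    ∀ x₀ x₁ u₀ u₁ : ℝ, ∃ t₀ > (0:ℝ), ∀ t : ℝ, t₀ ≤ t →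
      ∃ (n : ℕ) (σ : ℕ → ℝ) (y : ℕ → ℝ),
        0 < n ∧ σ 0 = 0 ∧ σ n = t ∧
        (∀ i < n, σ i < σ (i + 1)) ∧
        (∀ i, 1 ≤ i → i ≤ n → y i ∈ ({-1, 0, 1} : Set ℝ)) ∧
        ∃ x : ℝ → ℝ,
          ContinuousOn x (Set.Icc 0 t) ∧ x 0 = x₀ ∧
          (∀ i < n, ∀ s ∈ Set.Ioo (σ i) (σ (i + 1)), HasDerivAt x (y (i + 1)) s) ∧
          (∃ m : ℤ, x t - x₁ = 2 * π * m) ∧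
          u₀ + ∫ s in (0:ℝ)..t, F (x s) = u₁ := by
  intro x₀ x₁ u₀ u₁
  obtain ⟨a', ha'⟩ := hpos
  obtain ⟨b', hb'⟩ := hneg
  obtain ⟨a, ha, -, hFa⟩ := exists_gt_add_int_mul_eq hper x₀ a'
  obtain ⟨b, hb, -, hFb⟩ := exists_gt_add_int_mul_eq hper a b'
  obtain ⟨c, hc, ⟨m, hm⟩, -⟩ := exists_gt_add_int_mul_eq hper b x₁
  rw [← hFa] at ha'
  rw [← hFb] at hb'
  have hcont := hF.continuous
  set C := u₁ - u₀ - ∫ s in x₀..c, F s with hC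
  refine ⟨(c - x₀) + |C| / F a + |C| / (-F b) + 1, ?_, fun t ht => ?_⟩
  · have := div_nonneg (abs_nonneg C) ha'.le
    have := div_nonneg (abs_nonneg C) (neg_pos.2 hb').le
    linarith
  obtain ⟨p, q, hp, hq, hpq, hsum⟩ :=
    exists_pos_weights ha' hb' (T := t - (c - x₀)) (C := C) (by linarith)
  obtain rfl : t = c - x₀ + p + q := by linarith
  refine ⟨5, fun i => match i with
    | 0 => 0
    | 1 => a - x₀
    | 2 => a - x₀ + p
    | 3 => b - x₀ + p
    | 4 => b - x₀ + p + q
    | _ => c - x₀ + p + q, fun i => match i with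
    | 2 => 0
    | 4 => 0
    | _ => 1, by norm_num, rfl, rfl, ?_, ?_, pausedPath x₀ a b p q,
    (continuous_pausedPath ..).continuousOn, ?_, ?_, ⟨m, ?_⟩, ?_⟩
  · intro i hi
    interval_cases i
    · exact sub_pos.2 ha
    · exact lt_add_of_pos_right _ hp
    · exact add_lt_add_left (sub_lt_sub_right hb x₀) p
    · exact lt_add_of_pos_right _ hq
    · exact add_lt_add_left (add_lt_add_left (sub_lt_sub_right hc x₀) p) q
  · intro i h1 h2
    interval_cases i <;> simp
  · rw [pausedPath_of_le_fst] <;> linarith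
  · intro i hi s hs
    have key : ∀ {f : ℝ → ℝ} {v l r : ℝ}, HasDerivAt f v s → s ∈ Set.Ioo l r →
        Set.EqOn (pausedPath x₀ a b p q) f (Set.Icc l r) →
        HasDerivAt (pausedPath x₀ a b p q) v s := fun hf hs h =>
      hf.congr_of_eventuallyEq (h.eventuallyEq_of_mem (Icc_mem_nhds hs.1 hs.2))
    interval_cases i
    · exact key ((hasDerivAt_id s).const_add x₀) hs
        fun r hr => pausedPath_of_le_fst hr.2
    · exact key (hasDerivAt_const s a) hs
        fun r hr => pausedPath_of_mem_fst_pause hr.1 hr.2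
    · exact key ((hasDerivAt_id s).const_add (x₀ - p)) hs
        fun r hr => pausedPath_of_mem_between hp.le hr.1 hr.2
    · exact key (hasDerivAt_const s b) hs
        fun r hr => pausedPath_of_mem_snd_pause hb.le hp.le hr.1 hr.2
    · exact key ((hasDerivAt_id s).const_add (x₀ - p - q)) hs
        fun r hr => pausedPath_of_snd_le hb.le hp.le hq.le hr.1
  · rw [pausedPath_of_snd_le hb.le hp.le hq.le (by linarith), hm]
    ring
  · rw [integral_comp_pausedPath hcont ha.le hb.le hc.le hp.le hq.le]
    linarith
end

section
/- Let F : ℝ → ℝ be infinitely differentiable, 2π-periodic and non-constant. Fix t > 0, x₀, u₀, x₁ ∈ ℝ, u₁ ∈ (u₀ + t·(min F), u₀ + t·(max F)), and ε > 0. Then there exists a piecewise constant function v : [0,t] → ℝ such that the solution (x(s), u(s)) of the ordinary differential equation ẋ = v(s) − u F'(x), u̇ = F(x) with initial condition (x(0), u(0)) = (x₀, u₀) exists on [0,t] and satisfies x(t) − x₁ ∈ 2πℤ and |u(t) − u₁| ≤ ε. -/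
open Real

/-- Piecewise linear interpolation, on the grid of mesh `h`, of the values `Y 0, …, Y n`. -/
noncomputable def gridInterp (h : ℝ) (n : ℕ) (Y : ℕ → ℝ) (s : ℝ) : ℝ :=
  Y 0 + ∑ i ∈ Finset.range n, (Y (i + 1) - Y i) * max 0 (min 1 (s / h - i))

theorem continuous_gridInterp (h : ℝ) (n : ℕ) (Y : ℕ → ℝ) : Continuous (gridInterp h n Y) := by
  unfold gridInterp
  fun_prop

theorem gridInterp_eq {h : ℝ} (hh : 0 < h) {n k : ℕ} (hk : k < n) (Y : ℕ → ℝ) {s : ℝ}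
    (hs : s ∈ Set.Icc (k * h) ((k + 1) * h)) :
    gridInterp h n Y s = Y k + (Y (k + 1) - Y k) * (s / h - k) := by
  have h1 : (k : ℝ) ≤ s / h := (le_div_iff₀ hh).2 hs.1
  have h2 : s / h ≤ k + 1 := (div_le_iff₀ hh).2 hs.2
  unfold gridInterp
  induction n with
  | zero => omega
  | succ n ih =>
    rw [Finset.sum_range_succ]
    rcases Nat.lt_succ_iff_lt_or_eq.1 hk with hlt | rfl
    · have h3 : (k : ℝ) + 1 ≤ n := by exact_mod_cast hlt
      have h4 : max 0 (min 1 (s / h - n)) = 0 :=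
        max_eq_left ((min_le_right _ _).trans (by linarith))
      rw [h4, mul_zero, add_zero, ih hlt]
    · have h3 : ∑ i ∈ Finset.range k, (Y (i + 1) - Y i) * max 0 (min 1 (s / h - i))
          = ∑ i ∈ Finset.range k, (Y (i + 1) - Y i) := by
        refine Finset.sum_congr rfl fun i hi => ?_
        have h5 : (i : ℝ) + 1 ≤ k := by exact_mod_cast Finset.mem_range.1 hi
        rw [min_eq_left (by linarith), max_eq_right zero_le_one, mul_one]
      rw [h3, Finset.sum_range_sub, min_eq_right (by linarith), max_eq_right (by linarith)]
      ring

theorem gridInterp_grid {h : ℝ} (hh : 0 < h) {n k : ℕ} (hn : 0 < n) (hk : k ≤ n) (Y : ℕ → ℝ) :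
    gridInterp h n Y (k * h) = Y k := by
  rcases hk.lt_or_eq with hlt | rfl
  · rw [gridInterp_eq hh hlt Y ⟨le_rfl, by nlinarith⟩, mul_div_cancel_right₀ _ hh.ne']
    ring
  · obtain ⟨m, rfl⟩ := Nat.exists_eq_succ_of_ne_zero hn.ne'
    rw [gridInterp_eq hh (Nat.lt_succ_self m) Y
      ⟨by push_cast; nlinarith, by push_cast; exact le_rfl⟩, mul_div_cancel_right₀ _ hh.ne']
    push_cast
    ring

theorem exists_grid_cell {h t : ℝ} (hh : 0 < h) {n : ℕ} (hn : 0 < n) (hnt : n * h = t) {s : ℝ}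
    (hs : s ∈ Set.Icc 0 t) : ∃ k < n, s ∈ Set.Icc (k * h) ((k + 1) * h) := by
  rcases hs.2.lt_or_eq with hlt | rfl
  · have h0 : 0 ≤ s / h := div_nonneg hs.1 hh.le
    refine ⟨⌊s / h⌋₊, (Nat.floor_lt h0).2 ((div_lt_iff₀ hh).2 (hnt ▸ hlt)), ?_, ?_⟩
    · exact (le_div_iff₀ hh).1 (Nat.floor_le h0)
    · exact (div_le_iff₀ hh).1 (Nat.lt_floor_add_one _).le
  · obtain ⟨m, rfl⟩ := Nat.exists_eq_succ_of_ne_zero hn.ne'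
    refine ⟨m, Nat.lt_succ_self m, ?_, ?_⟩ <;> rw [← hnt] <;> push_cast <;> nlinarith

theorem gridInterp_sub (h : ℝ) (n : ℕ) (Y Z : ℕ → ℝ) (s : ℝ) :
    gridInterp h n Y s - gridInterp h n Z s = gridInterp h n (fun i => Y i - Z i) s := by
  unfold gridInterp
  rw [add_sub_add_comm, ← Finset.sum_sub_distrib]
  congr 1
  exact Finset.sum_congr rfl fun i _ => by ring

theorem abs_gridInterp_integral_sub_le {h t C : ℝ} (hh : 0 < h) {n : ℕ} (hn : 0 < n)
    (hnt : n * h = t) {g : ℝ → ℝ} (hg : Continuous g) (hC : ∀ s ∈ Set.Icc 0 t, |g s| ≤ C)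
    {s : ℝ} (hs : s ∈ Set.Icc 0 t) :
    |gridInterp h n (fun i => ∫ r in (0 : ℝ)..(i * h), g r) s - ∫ r in (0 : ℝ)..s, g r|
      ≤ 2 * h * C := by
  obtain ⟨k, hk, hs1, hs2⟩ := exists_grid_cell hh hn hnt hs
  have hC0 : 0 ≤ C := (abs_nonneg _).trans (hC s hs)
  have hkn : ((k : ℝ) + 1) * h ≤ t := by
    rw [← hnt]
    exact mul_le_mul_of_nonneg_right (by exact_mod_cast hk) hh.le
  have hk0 : 0 ≤ (k : ℝ) * h := by positivity
  have key : ∀ b ∈ Set.Icc (k * h) ((k + 1) * h), |∫ r in (k * h)..b, g r| ≤ C * h := by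
    intro b hb
    have h1 : ‖∫ r in (k * h)..b, g r‖ ≤ C * |b - k * h| := by
      refine intervalIntegral.norm_integral_le_of_norm_le_const fun r hr => ?_
      rw [Set.uIoc_of_le hb.1] at hr
      exact hC r ⟨hk0.trans hr.1.le, (hr.2.trans hb.2).trans hkn⟩
    refine h1.trans (mul_le_mul_of_nonneg_left ?_ hC0)
    rw [abs_of_nonneg (by linarith [hb.1])]
    linarith [hb.2]
  have hi : ∀ a b, IntervalIntegrable g MeasureTheory.volume a b := fun a b =>
    hg.intervalIntegrable a b
  rw [gridInterp_eq hh hk _ ⟨hs1, hs2⟩]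
  push_cast
  rw [intervalIntegral.integral_interval_sub_left (hi _ _) (hi _ _), add_sub_right_comm,
    ← neg_sub, intervalIntegral.integral_interval_sub_left (hi _ _) (hi _ _)]
  have a1 := key s ⟨hs1, hs2⟩
  have a2 := key ((k + 1) * h) ⟨hs1.trans hs2, le_rfl⟩
  have h1 : 0 ≤ s / h - k := sub_nonneg.2 ((le_div_iff₀ hh).2 hs1)
  have h2 : s / h - k ≤ 1 := by linarith [(div_le_iff₀ hh).2 hs2]
  have a3 : |(∫ r in (k * h)..((k + 1) * h), g r) * (s / h - k)| ≤ C * h := by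
    rw [abs_mul, abs_of_nonneg h1]
    exact (mul_le_of_le_one_right (abs_nonneg _) h2).trans a2
  refine (abs_add_le _ _).trans ?_
  rw [abs_neg]
  linarith

/-- The `u`-component driven by the position path `x`. -/
noncomputable def accum (F : ℝ → ℝ) (u₀ : ℝ) (x : ℝ → ℝ) (s : ℝ) : ℝ :=
  u₀ + ∫ r in (0 : ℝ)..s, F (x r)

/-- The self-interaction force `u F'(x)` along the position path `x`. -/
noncomputable def force (F : ℝ → ℝ) (u₀ : ℝ) (x : ℝ → ℝ) (s : ℝ) : ℝ :=
  accum F u₀ x s * deriv F (x s)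

theorem hasDerivAt_accum {F x : ℝ → ℝ} (hF : Continuous F) (hx : Continuous x) (u₀ s : ℝ) :
    HasDerivAt (accum F u₀ x) (F (x s)) s :=
  ((hF.comp hx).integral_hasStrictDerivAt 0 s).hasDerivAt.const_add u₀

theorem continuous_accum {F x : ℝ → ℝ} (hF : Continuous F) (hx : Continuous x) (u₀ : ℝ) :
    Continuous (accum F u₀ x) :=
  continuous_iff_continuousAt.2 fun s => (hasDerivAt_accum hF hx u₀ s).continuousAt

theorem continuous_force {F x : ℝ → ℝ} (hF : Continuous F) (hF' : Continuous (deriv F))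
    (hx : Continuous x) (u₀ : ℝ) : Continuous (force F u₀ x) :=
  (continuous_accum hF hx u₀).mul (hF'.comp hx)

theorem abs_accum_le {F x : ℝ → ℝ} {A t u₀ : ℝ} (hA : ∀ y, |F y| ≤ A) {s : ℝ}
    (hs : s ∈ Set.Icc 0 t) : |accum F u₀ x s| ≤ |u₀| + A * t := by
  have h1 : ‖∫ r in (0 : ℝ)..s, F (x r)‖ ≤ A * |s - 0| :=
    intervalIntegral.norm_integral_le_of_norm_le_const fun r _ => hA _
  rw [sub_zero, abs_of_nonneg hs.1] at h1
  have hA0 : 0 ≤ A := (abs_nonneg _).trans (hA 0)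
  exact (abs_add_le _ _).trans
    (add_le_add le_rfl (h1.trans (mul_le_mul_of_nonneg_left hs.2 hA0)))

theorem abs_force_le {F x : ℝ → ℝ} {A t u₀ : ℝ} (hA : ∀ y, |F y| ≤ A)
    (hA' : ∀ y, |deriv F y| ≤ A) {s : ℝ} (hs : s ∈ Set.Icc 0 t) :
    |force F u₀ x s| ≤ (|u₀| + A * t) * A := by
  rw [force, abs_mul]
  have h := abs_accum_le (x := x) (u₀ := u₀) hA hs
  exact mul_le_mul h (hA' _) (abs_nonneg _) ((abs_nonneg _).trans h)

theorem abs_force_sub_le {F x y : ℝ → ℝ} {A t u₀ d : ℝ} (hF : Continuous F)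
    (hx : Continuous x) (hy : Continuous y)
    (hA : ∀ y, |F y| ≤ A) (hA' : ∀ y, |deriv F y| ≤ A)
    (hL : ∀ a b, |F a - F b| ≤ A * |a - b|)
    (hL' : ∀ a b, |deriv F a - deriv F b| ≤ A * |a - b|)
    (hd : ∀ s ∈ Set.Icc 0 t, |x s - y s| ≤ d) {s : ℝ} (hs : s ∈ Set.Icc 0 t) :
    |force F u₀ x s - force F u₀ y s| ≤ (A * t * A + (|u₀| + A * t) * A) * d := by
  have hA0 : 0 ≤ A := (abs_nonneg _).trans (hA 0)
  have hd0 : 0 ≤ d := (abs_nonneg _).trans (hd s hs)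
  have h1 : |accum F u₀ x s - accum F u₀ y s| ≤ A * d * t := by
    have hFx : Continuous fun r => F (x r) := hF.comp hx
    have hFy : Continuous fun r => F (y r) := hF.comp hy
    rw [accum, accum, add_sub_add_left_eq_sub, ← intervalIntegral.integral_sub
      (hFx.intervalIntegrable _ _) (hFy.intervalIntegrable _ _)]
    have h2 : ‖∫ r in (0 : ℝ)..s, (F (x r) - F (y r))‖ ≤ A * d * |s - 0| := by
      refine intervalIntegral.norm_integral_le_of_norm_le_const fun r hr => ?_
      rw [Set.uIoc_of_le hs.1] at hr
      exact (hL _ _).trans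
        (mul_le_mul_of_nonneg_left (hd r ⟨hr.1.le, hr.2.trans hs.2⟩) hA0)
    rw [sub_zero, abs_of_nonneg hs.1] at h2
    exact h2.trans (mul_le_mul_of_nonneg_left hs.2 (by positivity))
  have h3 : |deriv F (x s) - deriv F (y s)| ≤ A * d :=
    (hL' _ _).trans (mul_le_mul_of_nonneg_left (hd s hs) hA0)
  have h4 := abs_accum_le (x := y) (u₀ := u₀) hA hs
  have h5 : force F u₀ x s - force F u₀ y s
      = (accum F u₀ x s - accum F u₀ y s) * deriv F (x s)
        + accum F u₀ y s * (deriv F (x s) - deriv F (y s)) := by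
    simp only [force]
    ring
  rw [h5]
  refine (abs_add_le _ _).trans ?_
  rw [abs_mul, abs_mul]
  have h6 := mul_le_mul h1 (hA' (x s)) (abs_nonneg _) ((abs_nonneg _).trans h1)
  have h7 := mul_le_mul h4 h3 (abs_nonneg _) ((abs_nonneg _).trans h4)
  linarith

/-- On a fine enough grid there is a path which solves the controlled equation, with a control
that is constant on every cell, and passes through prescribed points at the grid times. -/
theorem exists_controlled_path {F : ℝ → ℝ} {A t u₀ h : ℝ} (hF : Continuous F)
    (hF' : Continuous (deriv F))
    (hA : ∀ y, |F y| ≤ A) (hA' : ∀ y, |deriv F y| ≤ A)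
    (hL : ∀ a b, |F a - F b| ≤ A * |a - b|)
    (hL' : ∀ a b, |deriv F a - deriv F b| ≤ A * |a - b|)
    (hh : 0 < h) {n : ℕ} (hn : 0 < n) (hnt : n * h = t)
    (hsmall : 2 * h * (A * t * A + (|u₀| + A * t) * A) ≤ 1 / 2) (p : ℕ → ℝ) :
    ∃ x : ℝ → ℝ, Continuous x ∧ ∀ s ∈ Set.Icc 0 t,
      x s = gridInterp h n (fun i => p i + ∫ r in (0 : ℝ)..(i * h), force F u₀ x r) s
        - ∫ r in (0 : ℝ)..s, force F u₀ x r := by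
  have ht : (0 : ℝ) ≤ t := by rw [← hnt]; positivity
  let ext : C(Set.Icc 0 t, ℝ) → ℝ → ℝ := fun z => Set.IccExtend ht z
  have hext : ∀ z, Continuous (ext z) := fun z => z.continuous.Icc_extend'
  have hfc : ∀ z, Continuous (force F u₀ (ext z)) := fun z =>
    continuous_force hF hF' (hext z) u₀
  let Ψ : C(Set.Icc 0 t, ℝ) → ℝ → ℝ := fun z s =>
    gridInterp h n (fun i => p i + ∫ r in (0 : ℝ)..(i * h), force F u₀ (ext z) r) s
        - ∫ r in (0 : ℝ)..s, force F u₀ (ext z) r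
  have hΨ : ∀ z, Continuous (Ψ z) := fun z =>
    (continuous_gridInterp _ _ _).sub
      (intervalIntegral.continuous_primitive (fun a b => (hfc z).intervalIntegrable a b) 0)
  let Φ : C(Set.Icc 0 t, ℝ) → C(Set.Icc 0 t, ℝ) := fun z =>
    ⟨fun s => Ψ z s, (hΨ z).comp continuous_subtype_val⟩
  have hcontr : ContractingWith (1 / 2) Φ := by
    refine ⟨by rw [← NNReal.coe_lt_coe]; norm_num, LipschitzWith.of_dist_le_mul fun z w => ?_⟩
    refine (ContinuousMap.dist_le (by positivity)).2 fun s => ?_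
    have hd : ∀ r ∈ Set.Icc 0 t, |ext z r - ext w r| ≤ dist z w := fun r _ =>
      ContinuousMap.dist_apply_le_dist (f := z) (g := w) _
    have h1 := abs_gridInterp_integral_sub_le hh hn hnt ((hfc z).sub (hfc w))
      (fun r hr => abs_force_sub_le (u₀ := u₀) hF (hext z) (hext w) hA hA' hL hL' hd hr) s.2
    have h2 : Ψ z s - Ψ w s = gridInterp h n (fun i => ∫ r in (0 : ℝ)..(i * h),
        (force F u₀ (ext z) r - force F u₀ (ext w) r)) s
        - ∫ r in (0 : ℝ)..s, (force F u₀ (ext z) r - force F u₀ (ext w) r) := by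
      simp only [intervalIntegral.integral_sub ((hfc z).intervalIntegrable _ _)
        ((hfc w).intervalIntegrable _ _), Ψ]
      rw [sub_sub_sub_comm, gridInterp_sub]
      simp only [add_sub_add_left_eq_sub]
    rw [Real.dist_eq]
    change |Ψ z s - Ψ w s| ≤ _
    rw [h2]
    refine h1.trans ?_
    rw [← mul_assoc]
    refine mul_le_mul_of_nonneg_right (hsmall.trans (by norm_num)) dist_nonneg
  refine ⟨ext (hcontr.fixedPoint Φ), hext _, fun s hs => ?_⟩
  have h1 : Φ (hcontr.fixedPoint Φ) = hcontr.fixedPoint Φ := hcontr.fixedPoint_isFixedPt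
  have h2 : ext (hcontr.fixedPoint Φ) s = hcontr.fixedPoint Φ ⟨s, hs⟩ :=
    Set.IccExtend_of_mem ht _ hs
  rw [h2]
  exact (DFunLike.congr_fun h1 ⟨s, hs⟩).symm

theorem Function.Periodic.exists_abs_le {f : ℝ → ℝ} {c : ℝ} (hf : Function.Periodic f c)
    (hc : c ≠ 0) (hcont : Continuous f) : ∃ A, ∀ y, |f y| ≤ A := by
  obtain ⟨A, hA⟩ := (hf.compact_of_continuous hc hcont).isBounded.exists_norm_le
  exact ⟨A, fun y => hA _ ⟨y, rfl⟩⟩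

theorem Function.Periodic.periodic_deriv {f : ℝ → ℝ} {c : ℝ} (hf : Function.Periodic f c) :
    Function.Periodic (deriv f) c := fun x => by
  rw [← deriv_comp_add_const, funext hf]

theorem abs_sub_le_of_abs_deriv_le {f : ℝ → ℝ} (hf : Differentiable ℝ f) {A : ℝ}
    (hA : ∀ y, |deriv f y| ≤ A) (a b : ℝ) : |f a - f b| ≤ A * |a - b| :=
  convex_univ.norm_image_sub_le_of_norm_deriv_le (fun y _ => hf y) (fun y _ => hA y)
    (Set.mem_univ b) (Set.mem_univ a)

/-- Controllability for the diffusion `dX = dB − U F'(X) dt`, `dU = F(X) dt` on the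
circle: with a piecewise constant control `v`, from `(x₀, u₀)` the controlled ODE
`ẋ = v − u F'(x)`, `u̇ = F(x)` can reach at time `t` any position `x₁` modulo `2π`
and any value `u₁ ∈ (u₀ + t·min F, u₀ + t·max F)` up to precision `ε`. -/
theorem diffusion_controllability
    (F : ℝ → ℝ) (hF : ContDiff ℝ (⊤ : ℕ∞) F)
    (hper : Function.Periodic F (2 * π))
    (hnc : ∃ a b : ℝ, F a ≠ F b)
    (t : ℝ) (ht : 0 < t) (x₀ u₀ x₁ u₁ : ℝ)
    (hu₁ : u₀ + t * sInf (Set.range F) < u₁ ∧ u₁ < u₀ + t * sSup (Set.range F))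
    (ε : ℝ) (hε : 0 < ε) :
    ∃ (v : ℝ → ℝ) (n : ℕ) (σ : ℕ → ℝ),
      0 < n ∧ σ 0 = 0 ∧ σ n = t ∧
      (∀ i < n, σ i < σ (i + 1)) ∧
      (∀ i < n, ∀ s ∈ Set.Ico (σ i) (σ (i + 1)), v s = v (σ i)) ∧
      ∃ x u : ℝ → ℝ,
        ContinuousOn x (Set.Icc 0 t) ∧ ContinuousOn u (Set.Icc 0 t) ∧
        x 0 = x₀ ∧ u 0 = u₀ ∧
        (∀ i < n, ∀ s ∈ Set.Ioo (σ i) (σ (i + 1)),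
          HasDerivAt x (v s - u s * deriv F (x s)) s ∧ HasDerivAt u (F (x s)) s) ∧
        (∃ m : ℤ, x t - x₁ = 2 * π * m) ∧ |u t - u₁| ≤ ε := by
  have htwo : (2 * π) ≠ 0 := by positivity
  have hF0 : Continuous F := hF.continuous
  have hF1 : ContDiff ℝ 1 (deriv F) :=
    (contDiff_infty.1 hF 2 : ContDiff ℝ 2 F).deriv'
  have hF1c : Continuous (deriv F) := hF1.continuous
  obtain ⟨A₀, hA₀⟩ := hper.exists_abs_le htwo hF0
  obtain ⟨A₁, hA₁⟩ := hper.periodic_deriv.exists_abs_le htwo hF1c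
  obtain ⟨A₂, hA₂⟩ := hper.periodic_deriv.periodic_deriv.exists_abs_le htwo
    (hF1.continuous_deriv le_rfl)
  obtain ⟨A, hA, hA', hA''⟩ : ∃ A, (∀ y, |F y| ≤ A) ∧ (∀ y, |deriv F y| ≤ A) ∧
      ∀ y, |deriv (deriv F) y| ≤ A :=
    ⟨max A₀ (max A₁ A₂), fun y => (hA₀ y).trans (le_max_left _ _),
      fun y => (hA₁ y).trans ((le_max_left _ _).trans (le_max_right _ _)),
      fun y => (hA₂ y).trans ((le_max_right _ _).trans (le_max_right _ _))⟩
  have hL := abs_sub_le_of_abs_deriv_le (hF.differentiable (by simp)) hA'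
  have hL' := abs_sub_le_of_abs_deriv_le (hF1.differentiable (by simp)) hA''
  have hA0 : 0 ≤ A := (abs_nonneg _).trans (hA 0)
  obtain ⟨c, hc⟩ : ∃ c, F c = (u₁ - u₀) / t := by
    obtain ⟨_, ⟨a, rfl⟩, ha⟩ := exists_lt_of_csInf_lt (Set.range_nonempty F)
      (show sInf (Set.range F) < (u₁ - u₀) / t by rw [lt_div_iff₀ ht]; linarith [hu₁.1])
    obtain ⟨_, ⟨b, rfl⟩, hb⟩ := exists_lt_of_lt_csSup (Set.range_nonempty F)
      (show (u₁ - u₀) / t < sSup (Set.range F) by rw [div_lt_iff₀ ht]; linarith [hu₁.2])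
    exact mem_range_of_exists_le_of_exists_ge hF0 ⟨a, ha.le⟩ ⟨b, hb.le⟩
  set M : ℝ := (|u₀| + A * t) * A with hM
  have hM0 : 0 ≤ M := by positivity
  set R : ℝ := t * (4 * (A * t * A + M) + (4 * A + 2 * M * A * t) / ε) with hR
  obtain ⟨n, hn2, hnR⟩ : ∃ n : ℕ, 2 ≤ n ∧ R ≤ n := by
    obtain ⟨m, hm⟩ := exists_nat_ge R
    exact ⟨m + 2, by omega, by push_cast; linarith⟩
  have hn : 0 < n := by omega
  have hnr : (0 : ℝ) < n := by exact_mod_cast hn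
  obtain ⟨h, hh, hnt⟩ : ∃ h : ℝ, 0 < h ∧ n * h = t := ⟨t / n, by positivity, by field_simp⟩
  have hhR : h * (4 * (A * t * A + M) + (4 * A + 2 * M * A * t) / ε) ≤ 1 := by
    refine le_of_mul_le_mul_left ?_ hnr
    rw [← mul_assoc, hnt]
    simpa [hR] using hnR
  have hq : 0 ≤ (4 * A + 2 * M * A * t) / ε := by positivity
  have hq' : 0 ≤ A * t * A + M := by positivity
  have hsmall : 2 * h * (A * t * A + (|u₀| + A * t) * A) ≤ 1 / 2 := by
    rw [← hM]
    nlinarith [mul_nonneg hh.le hq]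
  have hsmall' : h * (4 * A + 2 * M * A * t) ≤ ε := by
    have h1 : h * ((4 * A + 2 * M * A * t) / ε) ≤ 1 := by nlinarith [mul_nonneg hh.le hq']
    rwa [← mul_div_assoc, div_le_one hε] at h1
  let p : ℕ → ℝ := fun i => if i = 0 then x₀ else if i = n then x₁ else c
  obtain ⟨x, hx, hxeq⟩ :=
    exists_controlled_path (u₀ := u₀) hF0 hF1c hA hA' hL hL' hh hn hnt hsmall p
  have hgc : Continuous (force F u₀ x) := continuous_force hF0 hF1c hx u₀
  set Y : ℕ → ℝ := fun i => p i + ∫ r in (0 : ℝ)..(i * h), force F u₀ x r with hY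
  have hxgrid : ∀ k ≤ n, x (k * h) = p k := by
    intro k hk
    rw [hxeq _ ⟨by positivity, by rw [← hnt]; gcongr⟩, gridInterp_grid hh hn hk, hY]
    simp
  have hmid : ∀ s ∈ Set.Icc h (t - h), |F (x s) - F c| ≤ A * (2 * h * M) := by
    intro s hs
    have hs' : s ∈ Set.Icc 0 t := ⟨hh.le.trans hs.1, by linarith [hs.2]⟩
    refine (hL _ _).trans (mul_le_mul_of_nonneg_left ?_ hA0)
    have h1 := abs_gridInterp_integral_sub_le hh hn hnt hgc
      (fun r hr => abs_force_le (u₀ := u₀) (x := x) hA hA' hr) hs'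
    have h2 : gridInterp h n p s = c := by
      obtain ⟨k, hk, hk1, hk2⟩ := exists_grid_cell hh hn hnt hs'
      rw [gridInterp_eq hh hk p ⟨hk1, hk2⟩]
      have hleft : k = 0 → s / h = 1 := by
        rintro rfl
        rw [div_eq_one_iff_eq hh.ne']
        exact le_antisymm (by simpa using hk2) hs.1
      have hright : k + 1 = n → s / h = k := by
        intro hkn
        have hkr : (k : ℝ) + 1 = n := by exact_mod_cast hkn
        rw [div_eq_iff hh.ne']
        refine le_antisymm ?_ hk1
        have := hs.2
        rw [← hnt, ← hkr] at this
        linarith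
      by_cases h0 : k = 0
      · have h01 : p (k + 1) = c := by simp [p, show k + 1 ≠ n by omega]
        rw [hleft h0, h01, h0]
        simp
      · have hkc : p k = c := by simp [p, h0, hk.ne]
        rw [hkc]
        by_cases h1n : k + 1 = n
        · rw [hright h1n]
          simp
        · have : p (k + 1) = c := by simp [p, h1n]
          simp [this]
    have h3 : gridInterp h n Y s - gridInterp h n
        (fun i => ∫ r in (0 : ℝ)..(i * h), force F u₀ x r) s = c := by
      rw [gridInterp_sub, ← h2]
      simp [hY]
    rw [hxeq s hs', show ∀ a b d : ℝ, a - b - d = (a - d) - b from fun a b d => by ring,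
      ← h3, sub_sub_cancel]
    exact h1
  have hcell : ∀ i : ℕ, ∀ s ∈ Set.Ico (i * h) ((i + 1) * h), ⌊s / h⌋₊ = i := by
    intro i s hs
    have h1 : (i : ℝ) ≤ s / h := (le_div_iff₀ hh).2 hs.1
    have h2 : s / h < i + 1 := (div_lt_iff₀ hh).2 hs.2
    exact (Nat.floor_eq_iff (i.cast_nonneg.trans h1)).2 ⟨h1, h2⟩
  let w : ℕ → ℝ := fun i => (Y (i + 1) - Y i) / h
  refine ⟨fun s => w ⌊s / h⌋₊, n, fun i => i * h, hn, by simp, hnt, fun i _ => ?_,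
    fun i _ s hs => ?_, x, accum F u₀ x, hx.continuousOn,
    (continuous_accum hF0 hx u₀).continuousOn, ?_, by simp [accum], fun i hi s hs => ⟨?_, ?_⟩,
    ⟨0, ?_⟩, ?_⟩
  · push_cast
    nlinarith
  · push_cast at hs
    beta_reduce
    rw [hcell i s hs, hcell i (i * h) ⟨le_rfl, by nlinarith⟩]
  · simpa [p] using hxgrid 0 hn.le
  · push_cast at hs
    have hwi : w ⌊s / h⌋₊ = w i := by rw [hcell i s ⟨hs.1.le, hs.2⟩]
    change HasDerivAt x (w ⌊s / h⌋₊ - force F u₀ x s) s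
    rw [hwi]
    have h1 : HasDerivAt (fun r => Y i + (Y (i + 1) - Y i) * (r / h - i)
        - ∫ q in (0 : ℝ)..r, force F u₀ x q) (w i - force F u₀ x s) s := by
      have h2 : HasDerivAt (fun r : ℝ => Y i + (Y (i + 1) - Y i) * (r / h - i)) (w i) s := by
        have := ((((hasDerivAt_id s).div_const h).sub_const (i : ℝ)).const_mul
          (Y (i + 1) - Y i)).const_add (Y i)
        simpa [w, div_eq_mul_inv] using this
      exact h2.sub (hgc.integral_hasStrictDerivAt 0 s).hasDerivAt
    refine h1.congr_of_eventuallyEq ?_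
    filter_upwards [Ioo_mem_nhds hs.1 hs.2] with r hr
    have hit : ((i : ℝ) + 1) * h ≤ t := by
      rw [← hnt]
      exact mul_le_mul_of_nonneg_right (by exact_mod_cast hi) hh.le
    rw [hxeq r ⟨(by positivity : (0 : ℝ) ≤ i * h).trans hr.1.le, hr.2.le.trans hit⟩,
      gridInterp_eq hh hi _ ⟨hr.1.le, hr.2.le⟩]
  · exact hasDerivAt_accum hF0 hx u₀ s
  · have h1 := hxgrid n le_rfl
    rw [hnt] at h1
    simp [h1, p, hn.ne']
  · have hi : ∀ a b, IntervalIntegrable (fun r => F (x r) - F c) MeasureTheory.volume a b :=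
      fun a b => ((hF0.comp hx).sub continuous_const).intervalIntegrable a b
    have h2h : 2 * h ≤ t := by
      rw [← hnt]
      exact mul_le_mul_of_nonneg_right (by exact_mod_cast hn2) hh.le
    have hend : ∀ r, ‖F (x r) - F c‖ ≤ 2 * A := fun r =>
      (norm_sub_le _ _).trans
        (by linarith [hA (x r), hA c, Real.norm_eq_abs (F (x r)), Real.norm_eq_abs (F c)])
    have h1 : accum F u₀ x t - u₁ = ∫ r in (0 : ℝ)..t, (F (x r) - F c) := by
      have hFx : Continuous fun r => F (x r) := hF0.comp hx
      rw [intervalIntegral.integral_sub (hFx.intervalIntegrable _ _)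
        (continuous_const.intervalIntegrable _ _), intervalIntegral.integral_const, accum, hc]
      simp only [smul_eq_mul, sub_zero, mul_div_cancel₀ _ ht.ne']
      ring
    have i1 : ‖∫ r in (0 : ℝ)..h, (F (x r) - F c)‖ ≤ 2 * A * |h - 0| :=
      intervalIntegral.norm_integral_le_of_norm_le_const fun r _ => hend r
    have i2 : ‖∫ r in h..(t - h), (F (x r) - F c)‖ ≤ A * (2 * h * M) * |t - h - h| := by
      refine intervalIntegral.norm_integral_le_of_norm_le_const fun r hr => ?_
      rw [Set.uIoc_of_le (by linarith)] at hr
      exact hmid r ⟨hr.1.le, hr.2⟩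
    have i3 : ‖∫ r in (t - h)..t, (F (x r) - F c)‖ ≤ 2 * A * |t - (t - h)| :=
      intervalIntegral.norm_integral_le_of_norm_le_const fun r _ => hend r
    rw [sub_zero, abs_of_pos hh] at i1
    rw [sub_sub_cancel, abs_of_pos hh] at i3
    rw [abs_of_nonneg (by linarith)] at i2
    have i2' : A * (2 * h * M) * (t - h - h) ≤ A * (2 * h * M) * t :=
      mul_le_mul_of_nonneg_left (by linarith) (by positivity)
    rw [h1, ← intervalIntegral.integral_add_adjacent_intervals (hi 0 (t - h)) (hi (t - h) t),
      ← intervalIntegral.integral_add_adjacent_intervals (hi 0 h) (hi h (t - h))]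
    refine (norm_add₃_le (E := ℝ)).trans ?_
    linarith
end
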